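/- arXiv:1610.07092 — 6 statements merged into one kernel-verified Lean document; each statement's English description precedes it below -/
import Mathlib

section
/- There is an absolute constant C > 0 such that the following holds. Let G be a finite abelian group and Γ a set of k characters of G. Then there is a Bohr system B on G with C^Δ(G;B₁) ≤ 1 and dim B ≤ C·k such that for every f : G → ℂ with supp f̂ ⊆ Γ and every ε ∈ (0,1], one has ‖τ_x(f) − f‖_{L_∞} ≤ ε·‖f‖_{A(G)} whenever x ∈ B_{ε/π}. -/
open scoped BigOperators Pointwise ENNReal ENat
open Real

namespace Paper

noncomputable section

/-- For `z` on the unit circle, `circNorm z = min {|θ| : z = exp(2πiθ)}`. -/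
def circNorm (z : ℂ) : ℝ := |z.arg| / (2 * Real.pi)

variable {G : Type} [AddCommGroup G]

/-- The (generalised) Bohr set with frequency set `Γ` and width function `δ`. -/
def bohrSet (Γ : Set (AddChar G ℂ)) (δ : AddChar G ℂ → ℝ) : Set G :=
  {x | ∀ γ ∈ Γ, circNorm (γ x) < δ γ}

/-- `(Γ, δ)` generates the family of sets `F` as a Bohr system. -/
def IsBohrGen (Γ : Set (AddChar G ℂ)) (δ : AddChar G ℂ → ℝ) (F : ℝ → Set G) : Prop :=
  (∀ γ ∈ Γ, 0 < δ γ) ∧ ∀ η : ℝ, 0 < η → η ≤ 1 → F η = bohrSet Γ (fun γ => η * δ γ)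

/-- A Bohr system: a family `(B_η)_{η ∈ (0,1]}` of subsets of `G` of the form
`B_η = Bohr(Γ, ηδ)` for some generating pair `(Γ, δ)`. -/
structure BohrSystem (G : Type) [AddCommGroup G] where
  sets : ℝ → Set G
  exists_gen : ∃ Γ δ, IsBohrGen Γ δ sets

/-- The covering number `C(S;T) = min {|X| : S ⊆ X + T}`, valued in `ℕ∞`. -/
def coveringNumber {H : Type} [AddCommGroup H] (S T : Set H) : ℕ∞ :=
  sInf {n : ℕ∞ | ∃ X : Finset H, (X.card : ℕ∞) = n ∧ S ⊆ (X : Set H) + T}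

/-- Auxiliary quantity for the difference covering number, for a fixed target group `H`. -/
def dCovAux (S T : Set G) (H : Type) [AddCommGroup H] : ℕ∞ :=
  ⨅ (φ : G →+ H) (U : Set H) (V : Set H) (_ : S ⊆ φ ⁻¹' U) (_ : φ ⁻¹' (V - V) ⊆ T),
    coveringNumber U V

/-- The difference covering number `C^Δ(S;T)`: the infimum of `C_H(U;V)` over all abelian
groups `H`, homomorphisms `φ : G → H` and sets `U, V ⊆ H` with `S ⊆ φ⁻¹(U)` and
`φ⁻¹(V − V) ⊆ T`. -/
def dCoveringNumber (S T : Set G) : ℕ∞ :=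
  ⨅ (H : Type) (inst : AddCommGroup H), @dCovAux G _ S T H inst

/-- Interpret an extended natural number as a real number. -/
def enatReal (n : ℕ∞) : ℝ := (n.toNat : ℝ)

/-- The dimension of a family of sets: `sup {log₂ C^Δ(F_η; F_{η/2}) : η ∈ (0,1]}`. -/
def dimOfSets (F : ℝ → Set G) : ℝ :=
  sSup {r : ℝ | ∃ η : ℝ, 0 < η ∧ η ≤ 1 ∧
    r = Real.logb 2 (enatReal (dCoveringNumber (F η) (F (η / 2))))}

/-- The dimension `dim B` of a Bohr system. -/
def BohrSystem.dim (B : BohrSystem G) : ℝ := dimOfSets B.sets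

/-- The doubling dimension of a family of sets:
`sup {log₂ C(F_η; F_{η/2}) : η ∈ (0,1]}`. -/
def dimStarOfSets (F : ℝ → Set G) : ℝ :=
  sSup {r : ℝ | ∃ η : ℝ, 0 < η ∧ η ≤ 1 ∧
    r = Real.logb 2 (enatReal (coveringNumber (F η) (F (η / 2))))}

/-- The doubling dimension `dim* B` of a Bohr system. -/
def BohrSystem.dimStar (B : BohrSystem G) : ℝ := dimStarOfSets B.sets

/-- `B' ≤ B` for Bohr systems, i.e. `B' ∧ B = B'`, i.e. `B'_η ⊆ B_η` for all `η ∈ (0,1]`. -/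
def BohrSystem.le (B' B : BohrSystem G) : Prop :=
  ∀ η : ℝ, 0 < η → η ≤ 1 → B'.sets η ⊆ B.sets η

/-- The width of a Bohr system: `inf {‖δ‖_{ℓ∞(Γ)} : (Γ,δ) generates B}`. -/
def BohrSystem.width (B : BohrSystem G) : ℝ :=
  sInf {r : ℝ | ∃ Γ δ, IsBohrGen Γ δ B.sets ∧ r = sSup (δ '' Γ)}

/-- The `n`-fold sumset `nS = S + ⋯ + S`. -/
def iterSum : ℕ → Set G → Set G
  | 0, _ => {0}
  | n + 1, S => S + iterSum n S

/-- The set of all cosets of subgroups of `G`. -/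
def cosets (G : Type) [AddCommGroup G] : Set (Set G) :=
  {W | ∃ (H : AddSubgroup G) (x : G), W = (fun h => x + h) '' (H : Set G)}

/-- The set of cosets of a fixed subgroup `H` of `G`. -/
def cosetsOf (H : AddSubgroup G) : Set (Set G) :=
  {W | ∃ x : G, W = (fun h => x + h) '' (H : Set G)}

/-- `f` is `ε`-almost integer-valued, with integer part `fZ`. -/
def AlmostInt (ε : ℝ) (f : G → ℂ) (fZ : G → ℤ) : Prop :=
  ∀ x, ‖f x - (fZ x : ℂ)‖ ≤ ε

/-- The `ρ`-approximate annihilator `N(S,ρ)` of a set `S ⊆ G`. -/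
def annihilator (S : Set G) (ρ : ℝ) : Set (AddChar G ℂ) :=
  {γ | ∀ x ∈ S, ‖(1 : ℂ) - γ x‖ < ρ}

/-- `A` is `(m,l)`-arithmetically connected. -/
def ArithConnected (m l : ℕ) (A : Set G) : Prop :=
  ∀ x : Fin m → G, (∀ i, x i ∈ A) →
    ∃ σ : Fin m → ℤ, (∑ i, (σ i).natAbs) ≤ l ∧
      (∃ i j, i ≠ j ∧ (σ i).natAbs = 1 ∧ (σ j).natAbs = 1) ∧
      (∑ i, σ i • x i) ∈ A

variable [Fintype G]

/-- The Haar probability measure of a subset of the finite group `G`. -/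
def haar (S : Set G) : ℝ := (Nat.card S : ℝ) / (Fintype.card G : ℝ)

/-- A probability measure on the finite group `G`, given by its weight function. -/
def IsProb (w : G → ℝ) : Prop := (∀ x, 0 ≤ w x) ∧ ∑ x, w x = 1

/-- The measure of `S` under the weight function `w`. -/
def wMeasure (w : G → ℝ) (S : Set G) : ℝ := ∑ x, S.indicator w x

/-- The probability measure `μ_S`: `μ` restricted to `S` and normalised. -/
def restrictProb (w : G → ℝ) (S : Set G) : G → ℝ :=
  fun x => S.indicator w x / wMeasure w S

/-- The probability measure `w` is `F`-approximately invariant: for every `η ∈ (0,1]` there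
are probability measures `w⁺, w⁻` with `(1−η)·w⁻ ≤ τ_x(w) ≤ (1+η)·w⁺` for all `x ∈ F η`. -/
def ApproxInvariant (F : ℝ → Set G) (w : G → ℝ) : Prop :=
  ∀ η : ℝ, 0 < η → η ≤ 1 → ∃ wp wm : G → ℝ, IsProb wp ∧ IsProb wm ∧
    ∀ x ∈ F η, ∀ y : G, (1 - η) * wm y ≤ w (y - x) ∧ w (y - x) ≤ (1 + η) * wp y

/-- The Fourier coefficient `f̂(γ) = (1/|G|) ∑_x f(x) conj(γ(x))`. -/
def fourierCoeff (f : G → ℂ) (γ : AddChar G ℂ) : ℂ :=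
  (Fintype.card G : ℂ)⁻¹ * ∑ x, f x * (starRingEnd ℂ) (γ x)

/-- The Wiener norm `‖f‖_{A(G)} = ∑_γ |f̂(γ)|`. -/
def wienerNorm (f : G → ℂ) : ℝ := ∑ᶠ γ : AddChar G ℂ, ‖fourierCoeff f γ‖

/-- The Fourier transform `μ̂(γ) = ∫ conj(γ(x)) dμ(x)` of a measure with weight `w`. -/
def fourierWeight (w : G → ℝ) (γ : AddChar G ℂ) : ℂ :=
  ∑ x, (starRingEnd ℂ) (γ x) * (w x : ℂ)

/-- Convolution `f ∗ μ (x) = ∫ f(x−y) dμ(y)` of a complex function with a measure. -/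
def convC (f : G → ℂ) (w : G → ℝ) (x : G) : ℂ := ∑ y, f (x - y) * (w y : ℂ)

/-- Convolution `f ∗ μ (x) = ∫ f(x−y) dμ(y)` of a real function with a measure. -/
def convR (f : G → ℝ) (w : G → ℝ) (x : G) : ℝ := ∑ y, f (x - y) * w y

/-- Convolution of functions w.r.t. Haar measure: `f ∗ g (x) = (1/|G|) ∑_y f(y) g(x−y)`. -/
def convFun (f g : G → ℝ) (x : G) : ℝ := (Fintype.card G : ℝ)⁻¹ * ∑ y, f y * g (x - y)

/-- The `L_p` norm `(∫ |f|^p dν)^{1/p}` w.r.t. the measure with weight `w`. -/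
def LpW (p : ℝ) (w : G → ℝ) (f : G → ℂ) : ℝ := (∑ y, w y * ‖f y‖ ^ p) ^ (1 / p)

/-- `X` has relative polynomial growth of order `d`. -/
def HasRPG (X : Set G) (d : ℝ) : Prop :=
  ∀ n : ℕ, 1 ≤ n → haar (iterSum n X) ≤ (n : ℝ) ^ d * haar X

end

lemma aux_abs_arg_le (a t : ℝ) (ha : |a| ≤ π) (h : (a : Real.Angle) = (t : Real.Angle)) :
    |a| ≤ |t| := by
  obtain ⟨k, hk⟩ := Real.Angle.angle_eq_iff_two_pi_dvd_sub.1 h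
  rcases eq_or_ne k 0 with rfl | hk0
  · have : a = t := by simpa [sub_eq_zero] using hk
    rw [this]
  · have h1 : (1 : ℝ) ≤ |(k : ℝ)| := by
      have := Int.one_le_abs hk0
      exact_mod_cast this
    have h2 : |a - t| = 2 * π * |(k : ℝ)| := by
      rw [hk, abs_mul, abs_of_pos Real.two_pi_pos]
    have h3 : |a - t| ≤ |a| + |t| := abs_sub a t
    nlinarith [Real.pi_pos]

lemma aux_norm_one {G : Type} [AddCommGroup G] [Finite G] (γ : AddChar G ℂ) (x : G) :
    ‖γ x‖ = 1 := AddChar.norm_apply γ x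

lemma aux_ne_zero {G : Type} [AddCommGroup G] [Finite G] (γ : AddChar G ℂ) (x : G) :
    γ x ≠ 0 := by
  intro h
  have := aux_norm_one γ x
  simp [h] at this

lemma aux_strict (z : ℂ) (hz : ‖z‖ = 1) (h1 : z.arg ≠ 0) : ‖z - 1‖ < |z.arg| := by
  have hz' : z = Complex.exp (z.arg * Complex.I) := by
    have := Complex.norm_mul_exp_arg_mul_I z
    rw [hz] at this
    simpa using this.symm
  have h2 : ‖z - 1‖ = ‖2 * Real.sin (z.arg / 2)‖ := by
    conv_lhs => rw [hz']
    rw [mul_comm, Complex.norm_exp_I_mul_ofReal_sub_one]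
  rw [h2, Real.norm_eq_abs, abs_mul, abs_two]
  have h3 : |Real.sin (z.arg / 2)| < |z.arg / 2| := Real.abs_sin_lt_abs (by simpa using h1)
  rw [abs_div, abs_two] at h3
  linarith

lemma aux_delta (G : Type) [AddCommGroup G] [Fintype G] :
    ∃ δ : ℝ, 1 / 2 < δ ∧ ∀ (γ : AddChar G ℂ) (x : G),
      ‖γ x - 1‖ * δ ≤ π * circNorm (γ x) := by
  have key : ∀ᶠ δ in nhdsWithin (1 / 2 : ℝ) (Set.Ioi (1 / 2)), ∀ (γ : AddChar G ℂ) (x : G),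
      ‖γ x - 1‖ * δ ≤ π * circNorm (γ x) := by
    rw [Filter.eventually_all]
    intro γ
    rw [Filter.eventually_all]
    intro x
    apply nhdsWithin_le_nhds
    by_cases h : (γ x).arg = 0
    · have h1 : γ x = 1 := by
        have := Complex.norm_mul_exp_arg_mul_I (γ x)
        rw [aux_norm_one, h] at this
        simpa using this.symm
      simp [h1, circNorm]
    · have hs := aux_strict _ (aux_norm_one γ x) h
      have hc : Filter.Tendsto (fun δ : ℝ => ‖γ x - 1‖ * δ) (nhds (1 / 2))
          (nhds (‖γ x - 1‖ * (1 / 2))) := (continuous_const.mul continuous_id).tendsto _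
      have hlt : ‖γ x - 1‖ * (1 / 2) < π * circNorm (γ x) := by
        have : π * circNorm (γ x) = |(γ x).arg| / 2 := by
          unfold circNorm
          field_simp
        rw [this]
        linarith
      filter_upwards [hc.eventually (gt_mem_nhds hlt)] with δ hδ using hδ.le
  obtain ⟨δ, h1, h2⟩ := (key.and self_mem_nhdsWithin).exists
  exact ⟨δ, h2, h1⟩

lemma aux_dcov_le {G : Type} [AddCommGroup G] {S T : Set G} {H : Type} [inst : AddCommGroup H]
    (φ : G →+ H) (U V : Set H) (hU : S ⊆ φ ⁻¹' U) (hV : φ ⁻¹' (V - V) ⊆ T)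
    (X : Finset H) (hX : U ⊆ (X : Set H) + V) : dCoveringNumber S T ≤ X.card := by
  unfold dCoveringNumber dCovAux
  refine (iInf₂_le H inst).trans ?_
  refine (iInf_le _ φ).trans ?_
  refine (iInf₂_le U V).trans ?_
  refine (iInf₂_le hU hV).trans ?_
  exact sInf_le ⟨X, rfl, hX⟩

/-- The homomorphism from `G` to the torus given by the arguments of the characters in `Γ`. -/
noncomputable def auxHom {G : Type} [AddCommGroup G] [Finite G] (Γ : Set (AddChar G ℂ)) :
    G →+ (Γ → Real.Angle) where
  toFun x := fun γ => ((γ.1 x).arg : Real.Angle)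
  map_zero' := by
    ext γ
    simp
  map_add' x y := by
    ext γ
    simp [AddChar.map_add_eq_mul,
      Complex.arg_mul_coe_angle (aux_ne_zero γ.1 x) (aux_ne_zero γ.1 y)]

/-- Boxes in the torus. -/
def auxBox (ι : Type) (a : ℝ) : Set (ι → Real.Angle) :=
  {z | ∀ i, ∃ θ : ℝ, |θ| < a ∧ z i = (θ : Real.Angle)}

lemma aux_cover {ι : Type} [Fintype ι] (a : ℝ) (ha : 0 < a) :
    ∃ X : Finset (ι → Real.Angle), X.card ≤ 8 ^ Fintype.card ι ∧
      auxBox ι a ⊆ (X : Set (ι → Real.Angle)) + auxBox ι (a / 4) := by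
  classical
  refine ⟨(Fintype.piFinset fun _ : ι => Finset.Icc (-4 : ℤ) 3).image
    (fun j i => ((j i * (a / 4) : ℝ) : Real.Angle)), ?_, ?_⟩
  · refine Finset.card_image_le.trans ?_
    simp [Fintype.card_piFinset]
  · intro z hz
    choose θ hθ hz using hz
    rw [Set.mem_add]
    have hfl : ∀ i, (⌊θ i / (a / 4)⌋ : ℝ) * (a / 4) ≤ θ i ∧
        θ i < (⌊θ i / (a / 4)⌋ + 1 : ℝ) * (a / 4) := by
      intro i
      have h4 : 0 < a / 4 := by positivity
      exact ⟨(le_div_iff₀ h4).1 (Int.floor_le _), (div_lt_iff₀ h4).1 (Int.lt_floor_add_one _)⟩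
    refine ⟨fun i => (((⌊θ i / (a / 4)⌋ : ℤ) * (a / 4) : ℝ) : Real.Angle), ?_,
      fun i => ((θ i - (⌊θ i / (a / 4)⌋ : ℤ) * (a / 4) : ℝ) : Real.Angle), ?_, ?_⟩
    · rw [Finset.mem_coe, Finset.mem_image]
      refine ⟨fun i => ⌊θ i / (a / 4)⌋, ?_, rfl⟩
      rw [Fintype.mem_piFinset]
      intro i
      have h := abs_lt.1 (hθ i)
      rw [Finset.mem_Icc]
      constructor
      · rw [Int.le_floor, le_div_iff₀ (by positivity)]
        push_cast
        linarith
      · rw [← Int.lt_add_one_iff, Int.floor_lt, div_lt_iff₀ (by positivity)]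
        push_cast
        linarith
    · intro i
      refine ⟨_, ?_, rfl⟩
      have := hfl i
      rw [abs_lt]
      constructor <;> linarith
    · ext i
      simp only [Pi.add_apply]
      rw [hz, ← Real.Angle.coe_add]
      congr 1
      ring

lemma aux_dim {G : Type} [AddCommGroup G] [Fintype G] (Γ : Set (AddChar G ℂ)) (r : ℝ)
    (hr : 0 < r) :
    dCoveringNumber (bohrSet Γ fun _ => r) (bohrSet Γ fun _ => r / 2)
      ≤ ((8 ^ Γ.ncard : ℕ) : ℕ∞) := by
  classical
  have : Finite Γ := inferInstance
  have : Fintype Γ := Fintype.ofFinite Γ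
  have hpi := Real.two_pi_pos
  obtain ⟨X, hc, hX⟩ := aux_cover (ι := Γ) (2 * π * r) (by positivity)
  have hcard : Fintype.card Γ = Γ.ncard := by
    rw [← Nat.card_eq_fintype_card, Nat.card_coe_set_eq]
  rw [hcard] at hc
  refine (aux_dcov_le (auxHom Γ) (auxBox Γ (2 * π * r)) (auxBox Γ (2 * π * r / 4))
    ?_ ?_ X hX).trans (by exact_mod_cast hc)
  · intro x hx γ
    refine ⟨_, ?_, rfl⟩
    have := hx γ.1 γ.2
    unfold circNorm at this
    rw [div_lt_iff₀ hpi] at this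
    linarith
  · rintro x hx γ hγ
    obtain ⟨u, hu, v, hv, huv⟩ := Set.mem_sub.1 hx
    obtain ⟨s, hs, hs'⟩ := hu ⟨γ, hγ⟩
    obtain ⟨t, ht, ht'⟩ := hv ⟨γ, hγ⟩
    have h1 : ((γ x).arg : Real.Angle) = ((s - t : ℝ) : Real.Angle) := by
      have h2 := congrFun huv ⟨γ, hγ⟩
      rw [Pi.sub_apply, hs', ht', ← Real.Angle.coe_sub] at h2
      exact h2.symm
    have h3 := aux_abs_arg_le _ _ (Complex.abs_arg_le_pi _) h1
    have h4 : |s - t| ≤ |s| + |t| := abs_sub s t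
    unfold circNorm
    rw [div_lt_iff₀ hpi]
    linarith

lemma aux_inversion {G : Type} [AddCommGroup G] [Fintype G] (f : G → ℂ) (y : G) :
    f y = ∑ γ : AddChar G ℂ, fourierCoeff f γ * γ y := by
  classical
  have hG : (Fintype.card G : ℂ) ≠ 0 := by simp
  have h : ∀ x, ∑ γ : AddChar G ℂ, (starRingEnd ℂ) (γ x) * γ y
      = if x = y then (Fintype.card G : ℂ) else 0 := by
    intro x
    have := AddChar.sum_apply_eq_ite (α := G) (y - x)
    simp only [sub_eq_zero] at this
    rw [eq_comm (a := x), ← this]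
    refine Finset.sum_congr rfl fun γ _ => ?_
    rw [sub_eq_add_neg, AddChar.map_add_eq_mul, AddChar.map_neg_eq_conj, mul_comm]
  have h2 : ∑ γ : AddChar G ℂ, fourierCoeff f γ * γ y
      = (Fintype.card G : ℂ)⁻¹ * ∑ x, f x * ∑ γ : AddChar G ℂ, (starRingEnd ℂ) (γ x) * γ y := by
    unfold fourierCoeff
    simp only [Finset.mul_sum, Finset.sum_mul]
    rw [Finset.sum_comm]
    refine Finset.sum_congr rfl fun x _ => Finset.sum_congr rfl fun γ _ => ?_
    ring
  rw [h2]
  simp only [h]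
  simp
  field_simp

/-- Lemma 6.4, Bohr sets as approximate invariance sets. -/
theorem statement13 :
    ∃ C : ℝ, 0 < C ∧
      ∀ (G : Type) [AddCommGroup G] [Fintype G], ∀ (Γ : Set (AddChar G ℂ)) (k : ℕ),
        Γ.ncard = k →
        ∃ B : BohrSystem G,
          dCoveringNumber (Set.univ : Set G) (B.sets 1) ≤ 1 ∧
          B.dim ≤ C * (k : ℝ) ∧
          ∀ f : G → ℂ, (∀ γ : AddChar G ℂ, fourierCoeff f γ ≠ 0 → γ ∈ Γ) →
            ∀ ε : ℝ, 0 < ε → ε ≤ 1 → ∀ x ∈ B.sets (ε / Real.pi), ∀ y : G,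
              ‖f (y - x) - f y‖ ≤ ε * wienerNorm f := by
  refine ⟨3, by norm_num, ?_⟩
  intro G _ _ Γ k hk
  obtain ⟨δ, hδ, hδ2⟩ := aux_delta G
  have hδ0 : 0 < δ := by linarith
  refine ⟨⟨fun η => bohrSet Γ fun _ => η * δ, Γ, fun _ => δ, fun _ _ => hδ0, fun _ _ _ => rfl⟩,
    ?_, ?_, ?_⟩
  · have h := aux_dcov_le (S := (Set.univ : Set G)) (T := bohrSet Γ fun _ => 1 * δ)
      (AddMonoidHom.id G) Set.univ Set.univ (fun _ _ => trivial) ?_ {0} ?_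
    · simpa using h
    · intro x _ γ _
      have h1 := Complex.abs_arg_le_pi (γ x)
      unfold circNorm
      rw [div_lt_iff₀ Real.two_pi_pos]
      nlinarith [Real.pi_pos]
    · simp
  · show dimOfSets _ ≤ _
    unfold dimOfSets
    refine Real.sSup_le ?_ (by positivity)
    rintro r ⟨η, hη, hη1, rfl⟩
    have h := aux_dim Γ (η * δ) (by positivity)
    rw [hk] at h
    have he : η / 2 * δ = η * δ / 2 := by ring
    simp only [he]
    set N := dCoveringNumber (bohrSet Γ fun _ => η * δ) (bohrSet Γ fun _ => η * δ / 2)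
    have hN : N.toNat ≤ 8 ^ k := by
      have := ENat.toNat_le_toNat h (ENat.natCast_ne_top _)
      rwa [ENat.toNat_natCast] at this
    unfold enatReal
    rcases Nat.eq_zero_or_pos N.toNat with h0 | h0
    · rw [h0]
      simp
    · have h1 : (N.toNat : ℝ) ≤ (2 : ℝ) ^ (3 * (k : ℝ)) := by
        rw [Real.rpow_mul (by norm_num), Real.rpow_natCast]
        have : ((2 : ℝ) ^ (3 : ℝ)) = 8 := by norm_num
        rw [this]
        exact_mod_cast hN
      rw [Real.logb_le_iff_le_rpow (by norm_num) (by exact_mod_cast h0)]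
      exact h1
  · intro f hf ε hε hε1 x hx y
    have hW : wienerNorm f = ∑ γ : AddChar G ℂ, ‖fourierCoeff f γ‖ :=
      finsum_eq_sum_of_fintype _
    rw [hW, aux_inversion f (y - x), aux_inversion f y, ← Finset.sum_sub_distrib, Finset.mul_sum]
    refine (norm_sum_le _ _).trans (Finset.sum_le_sum fun γ _ => ?_)
    by_cases h0 : fourierCoeff f γ = 0
    · simp [h0]
    have hb : circNorm (γ x) < ε / π * δ := hx γ (hf γ h0)
    have h1 := hδ2 γ x
    have h2 : ‖γ x - 1‖ ≤ ε := by
      have h3 : π * circNorm (γ x) < ε * δ := by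
        calc π * circNorm (γ x) < π * (ε / π * δ) := by gcongr
          _ = ε * δ := by field_simp
      by_contra! h4
      nlinarith
    have h5 : γ y = γ (y - x) * γ x := by
      rw [← AddChar.map_add_eq_mul, sub_add_cancel]
    rw [h5, ← mul_sub, norm_mul, mul_comm ε]
    gcongr
    have h6 : γ (y - x) - γ (y - x) * γ x = -(γ (y - x) * (γ x - 1)) := by ring
    rw [h6, norm_neg, norm_mul, aux_norm_one, one_mul]
    exact h2

end Paper
end

section
/- Let G be a finite abelian group, B a Bohr system on G, μ a B-approximately invariant probability measure on G, and κ, η ∈ (0,1]. Then {γ ∈ Ĝ : |μ̂(γ)| > κ} ⊆ N(B_{κη/2}, η). -/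
open scoped BigOperators Pointwise ENNReal ENat
open Real

namespace Paper

/-- Lemma 4.1, majorising annihilators. -/
theorem statement14 :
    ∀ (G : Type) [AddCommGroup G] [Fintype G],
      ∀ (B : BohrSystem G) (μ : G → ℝ) (κ η : ℝ),
        IsProb μ → ApproxInvariant B.sets μ → 0 < κ → κ ≤ 1 → 0 < η → η ≤ 1 →
        {γ : AddChar G ℂ | κ < ‖fourierWeight μ γ‖} ⊆
          annihilator (B.sets (κ * η / 2)) η := by
  intro G _ _ B μ κ η hμ hinv hκ hκ1 hη hη1 γ hγ x hx
  have hγ' : κ < ‖fourierWeight μ γ‖ := hγ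
  have hε : 0 < κ * η / 2 := by positivity
  have hε1 : κ * η / 2 ≤ 1 := by nlinarith
  obtain ⟨wp, wm, hwp, hwm, hb⟩ := hinv (κ * η / 2) hε hε1
  have h0 : (0 : G) ∈ B.sets (κ * η / 2) := by
    obtain ⟨Γ, δ, hδ, hF⟩ := B.exists_gen
    rw [hF _ hε hε1]
    intro χ hχ
    have := hδ χ hχ
    simp only [circNorm, AddChar.map_zero_eq_one, Complex.arg_one, abs_zero, zero_div]
    positivity
  have hsum : ∑ y, |μ y - μ (y - x)| ≤ κ * η := by
    calc ∑ y, |μ y - μ (y - x)|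
        ≤ ∑ y, ((1 + κ * η / 2) * wp y - (1 - κ * η / 2) * wm y) := by
          apply Finset.sum_le_sum
          intro y _
          have h1 := hb x hx y
          have h2 := hb 0 h0 y
          rw [sub_zero] at h2
          rw [abs_le]
          constructor <;> linarith [h1.1, h1.2, h2.1, h2.2]
      _ = κ * η := by
          rw [Finset.sum_sub_distrib, ← Finset.mul_sum, ← Finset.mul_sum, hwp.2, hwm.2]
          ring
  have hshift : ∑ y, (starRingEnd ℂ) (γ y) * (μ (y - x) : ℂ)
      = (starRingEnd ℂ) (γ x) * fourierWeight μ γ := by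
    rw [fourierWeight, Finset.mul_sum, ← Equiv.sum_comp (Equiv.addRight x)]
    apply Finset.sum_congr rfl
    intro y _
    simp only [Equiv.coe_addRight, add_sub_cancel_right, AddChar.map_add_eq_mul, map_mul]
    ring
  have hdiff : (starRingEnd ℂ) (1 - γ x) * fourierWeight μ γ
      = ∑ y, (starRingEnd ℂ) (γ y) * ((μ y - μ (y - x) : ℝ) : ℂ) := by
    rw [map_sub, map_one, sub_mul, one_mul, ← hshift, fourierWeight, ← Finset.sum_sub_distrib]
    apply Finset.sum_congr rfl
    intro y _
    push_cast
    ring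
  have hle : ‖(1 : ℂ) - γ x‖ * ‖fourierWeight μ γ‖ ≤ κ * η := by
    rw [← RCLike.norm_conj (1 - γ x), ← norm_mul, hdiff]
    refine (norm_sum_le _ _).trans (le_trans (le_of_eq ?_) hsum)
    apply Finset.sum_congr rfl
    intro y _
    rw [norm_mul, RCLike.norm_conj, AddChar.norm_apply, one_mul, Complex.norm_real,
      Real.norm_eq_abs]
  by_contra hcon
  have hcon' : η ≤ ‖(1 : ℂ) - γ x‖ := not_lt.mp hcon
  nlinarith [mul_le_mul_of_nonneg_right hcon' (norm_nonneg (fourierWeight μ γ)),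
    mul_lt_mul_of_pos_left hγ' hη]

end Paper
end

section
/- Let G be a finite abelian group, let S, T ⊆ G be nonempty with m_G(S+T) ≤ K·m_G(S), and let ε ∈ (0,1]. Then {γ ∈ Ĝ : |1̂_{S+T}(γ)| > (1−ε)·m_G(S+T)} ⊆ N(T−T, 2·√(2εK)). -/
open scoped BigOperators Pointwise ENNReal ENat
open Real

namespace Paper

theorem spec_aux {G : Type} [AddCommGroup G] [Fintype G] (γ : AddChar G ℂ)
    (A B : Finset G) (K ε : ℝ) (hB : B.Nonempty) (t t' : G)
    (ht : ∀ s ∈ B, s + t ∈ A) (ht' : ∀ s ∈ B, s + t' ∈ A)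
    (hK : (A.card : ℝ) ≤ K * B.card) (hε : 0 < ε)
    (h : (1 - ε) * A.card < ‖∑ x ∈ A, (starRingEnd ℂ) (γ x)‖) :
    ‖(1 : ℂ) - γ (t - t')‖ < 2 * Real.sqrt (2 * ε * K) := by
  classical
  set c : ℂ := ∑ x ∈ A, (starRingEnd ℂ) (γ x) with hc
  obtain ⟨w, hw, hwc⟩ : ∃ w : ℂ, ‖w‖ = 1 ∧ w * c = (‖c‖ : ℂ) := by
    by_cases h0 : c = 0
    · exact ⟨1, by simp, by simp [h0]⟩
    · have hn : (‖c‖ : ℂ) ≠ 0 := by simpa using h0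
      refine ⟨(starRingEnd ℂ) c / ‖c‖, ?_, ?_⟩
      · have : ‖c‖ ≠ 0 := by simpa using h0
        simp [this]
      · rw [div_mul_eq_mul_div, Complex.conj_mul', div_eq_iff hn]; ring
  have hγ : ∀ x, ‖γ x‖ = 1 := fun x => AddChar.norm_apply γ x
  have hu : ∀ x, ‖1 - w * (starRingEnd ℂ) (γ x)‖ ^ 2
      = 2 - 2 * (w * (starRingEnd ℂ) (γ x)).re := by
    intro x
    have h1 : ‖w * (starRingEnd ℂ) (γ x)‖ ^ 2 = 1 := by simp [hw, hγ]
    rw [← Complex.normSq_eq_norm_sq, Complex.normSq_apply] at h1 ⊢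
    simp only [Complex.sub_re, Complex.sub_im, Complex.one_re, Complex.one_im]
    nlinarith
  have hsum : ∑ x ∈ A, ‖1 - w * (starRingEnd ℂ) (γ x)‖ ^ 2 = 2 * A.card - 2 * ‖c‖ := by
    have h2 : ∑ x ∈ A, (w * (starRingEnd ℂ) (γ x)).re = ‖c‖ := by
      rw [← Complex.re_sum, ← Finset.mul_sum, ← hc, hwc, Complex.ofReal_re]
    simp_rw [hu]
    rw [Finset.sum_sub_distrib, ← Finset.mul_sum, h2]
    simp [mul_comm]
  have hpart : ∀ r : G, (∀ s ∈ B, s + r ∈ A) →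
      ∑ s ∈ B, ‖1 - w * (starRingEnd ℂ) (γ (s + r))‖ ^ 2 < 2 * ε * A.card := by
    intro r hr
    have h3 : ∑ s ∈ B, ‖1 - w * (starRingEnd ℂ) (γ (s + r))‖ ^ 2
        = ∑ x ∈ B.image (· + r), ‖1 - w * (starRingEnd ℂ) (γ x)‖ ^ 2 := by
      rw [Finset.sum_image]
      intro a _ b _ hab
      exact add_right_cancel hab
    have h4 : B.image (· + r) ⊆ A := by
      intro x hx
      obtain ⟨s, hs, rfl⟩ := Finset.mem_image.1 hx
      exact hr s hs
    have h5 := Finset.sum_le_sum_of_subset_of_nonneg h4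
      (f := fun x => ‖1 - w * (starRingEnd ℂ) (γ x)‖ ^ 2) (fun _ _ _ => by positivity)
    rw [h3]
    linarith
  have hpt : ∀ s, ‖(1 : ℂ) - γ (t - t')‖ ^ 2 ≤
      2 * ‖1 - w * (starRingEnd ℂ) (γ (s + t))‖ ^ 2
        + 2 * ‖1 - w * (starRingEnd ℂ) (γ (s + t'))‖ ^ 2 := by
    intro s
    have h6 : ‖(1 : ℂ) - γ (t - t')‖
        = ‖(1 - w * (starRingEnd ℂ) (γ (s + t))) - (1 - w * (starRingEnd ℂ) (γ (s + t')))‖ := by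
      have h7 : (1 - w * (starRingEnd ℂ) (γ (s + t))) - (1 - w * (starRingEnd ℂ) (γ (s + t')))
          = w * (starRingEnd ℂ) (γ (s + t') * (1 - γ (t - t'))) := by
        have : s + t = (s + t') + (t - t') := by abel
        rw [this, AddChar.map_add_eq_mul]
        simp only [map_mul, map_sub, map_one]
        ring
      rw [h7, norm_mul, hw, RCLike.norm_conj, norm_mul, hγ]
      simp
    have h8 := norm_sub_le (1 - w * (starRingEnd ℂ) (γ (s + t)))
      (1 - w * (starRingEnd ℂ) (γ (s + t')))
    rw [← h6] at h8
    set a := ‖1 - w * (starRingEnd ℂ) (γ (s + t))‖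
    set b := ‖1 - w * (starRingEnd ℂ) (γ (s + t'))‖
    have h9 := norm_nonneg ((1 : ℂ) - γ (t - t'))
    nlinarith [sq_nonneg (a - b), pow_le_pow_left₀ h9 h8 2]
  have hfin := Finset.sum_le_sum (fun s (_ : s ∈ B) => hpt s)
  rw [Finset.sum_add_distrib, ← Finset.mul_sum, ← Finset.mul_sum, Finset.sum_const,
    nsmul_eq_mul] at hfin
  have ha := hpart t ht
  have hb := hpart t' ht'
  have hBpos : (0 : ℝ) < B.card := by exact_mod_cast hB.card_pos
  have hlt : (B.card : ℝ) * ‖(1 : ℂ) - γ (t - t')‖ ^ 2 < B.card * (8 * ε * K) := by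
    have := mul_le_mul_of_nonneg_left hK hε.le
    nlinarith
  have hlt2 := lt_of_mul_lt_mul_left hlt hBpos.le
  have h10 : ‖(1 : ℂ) - γ (t - t')‖ / 2 < Real.sqrt (2 * ε * K) := by
    apply Real.lt_sqrt_of_sq_lt
    nlinarith
  linarith

/-- Lemma 4.2, large spectrum of sumsets. -/
theorem statement15 :
    ∀ (G : Type) [AddCommGroup G] [Fintype G],
      ∀ (S T : Set G) (K ε : ℝ),
        S.Nonempty → T.Nonempty → haar (S + T) ≤ K * haar S → 0 < ε → ε ≤ 1 →
        {γ : AddChar G ℂ |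
            (1 - ε) * haar (S + T) < ‖fourierCoeff ((S + T).indicator (1 : G → ℂ)) γ‖} ⊆
          annihilator (T - T) (2 * Real.sqrt (2 * ε * K)) := by
  intro G _ _ S T K ε hS hT hK hε hε1 γ hγ x hx
  classical
  obtain ⟨t, ht, t', ht', rfl⟩ := Set.mem_sub.1 hx
  have hG : (0 : ℝ) < Fintype.card G := by exact_mod_cast Fintype.card_pos
  have hcard : ∀ (U : Set G) [Fintype U], haar U * Fintype.card G = U.toFinset.card := by
    intro U _
    rw [haar, div_mul_cancel₀ _ hG.ne', Nat.card_eq_fintype_card, Set.toFinset_card]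
  refine spec_aux γ (S + T).toFinset S.toFinset K ε (by simpa using hS) t t' ?_ ?_ ?_ hε ?_
  · intro s hs
    exact Set.mem_toFinset.2 (Set.add_mem_add (Set.mem_toFinset.1 hs) ht)
  · intro s hs
    exact Set.mem_toFinset.2 (Set.add_mem_add (Set.mem_toFinset.1 hs) ht')
  · rw [← hcard, ← hcard, ← mul_assoc]
    exact mul_le_mul_of_nonneg_right hK hG.le
  · have h1 : (1 - ε) * haar (S + T) < ‖fourierCoeff ((S + T).indicator (1 : G → ℂ)) γ‖ := hγ
    have h2 : ∑ x, (S + T).indicator (1 : G → ℂ) x * (starRingEnd ℂ) (γ x)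
        = ∑ x ∈ (S + T).toFinset, (starRingEnd ℂ) (γ x) := by
      rw [← Finset.sum_subset (Finset.subset_univ (S + T).toFinset)]
      · refine Finset.sum_congr rfl fun x hx => ?_
        rw [Set.indicator_of_mem (Set.mem_toFinset.1 hx)]
        simp
      · intro x _ hx
        rw [Set.indicator_of_notMem (fun h => hx (Set.mem_toFinset.2 h))]
        simp
    rw [fourierCoeff, h2, norm_mul, norm_inv, Complex.norm_natCast] at h1
    rw [← hcard, ← mul_assoc]
    have h3 := mul_lt_mul_of_pos_right h1 hG
    rwa [mul_right_comm (_⁻¹), inv_mul_cancel₀ hG.ne', one_mul] at h3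

end Paper
end

section
/- Let G be a finite abelian group, B a Bohr system on G, and X ⊆ G nonempty with m_G(X+B₁) ≤ K·m_G(X). Then there exists λ with 1 ≥ λ ≥ 1/(24·log(2K)) and a (λB)-approximately invariant probability measure whose support is contained in X + B₁. -/
open scoped BigOperators Pointwise ENNReal ENat
open Real

namespace Paper

lemma abs_arg_mul_le' {z w : ℂ} (hz : z ≠ 0) (hw : w ≠ 0) :
    |(z * w).arg| ≤ |z.arg| + |w.arg| := by
  have h := InnerProductGeometry.angle_le_angle_add_angle z (1 : ℂ) w⁻¹
  rw [Complex.angle_eq_abs_arg hz (inv_ne_zero hw), Complex.angle_one_right hz,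
    Complex.angle_one_left (inv_ne_zero hw), Complex.abs_arg_inv, div_inv_eq_mul] at h
  exact h

lemma circNorm_mul_le {z w : ℂ} (hz : z ≠ 0) (hw : w ≠ 0) :
    circNorm (z * w) ≤ circNorm z + circNorm w := by
  unfold circNorm
  rw [← add_div]
  have := Real.pi_pos
  gcongr
  exact abs_arg_mul_le' hz hw

lemma addChar_ne_zero {G : Type} [AddCommGroup G] (γ : AddChar G ℂ) (x : G) : γ x ≠ 0 := by
  intro h
  have h1 : γ (x + -x) = 1 := by simp
  rw [AddChar.map_add_eq_mul, h, zero_mul] at h1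
  exact zero_ne_one h1

section BohrFacts

variable {G : Type} [AddCommGroup G] (B : BohrSystem G)

lemma bohr_zero_mem {s : ℝ} (h0 : 0 < s) (h1 : s ≤ 1) : (0 : G) ∈ B.sets s := by
  obtain ⟨Γ, δ, hpos, h⟩ := B.exists_gen
  rw [h s h0 h1]
  intro γ hγ
  simp only [AddChar.map_zero_eq_one, circNorm, Complex.arg_one, abs_zero, zero_div]
  exact mul_pos h0 (hpos γ hγ)

lemma bohr_neg_mem {s : ℝ} (h0 : 0 < s) (h1 : s ≤ 1) {x : G} (hx : x ∈ B.sets s) :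
    -x ∈ B.sets s := by
  obtain ⟨Γ, δ, hpos, h⟩ := B.exists_gen
  rw [h s h0 h1] at hx ⊢
  intro γ hγ
  have := hx γ hγ
  simpa [circNorm, AddChar.map_neg_eq_inv] using this

lemma bohr_add_mem {s t : ℝ} (hs : 0 < s) (ht : 0 < t) (h1 : s + t ≤ 1) {x y : G}
    (hx : x ∈ B.sets s) (hy : y ∈ B.sets t) : x + y ∈ B.sets (s + t) := by
  obtain ⟨Γ, δ, hpos, h⟩ := B.exists_gen
  rw [h s hs (by linarith)] at hx
  rw [h t ht (by linarith)] at hy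
  rw [h (s + t) (by linarith) h1]
  intro γ hγ
  have h2 := hx γ hγ
  have h3 := hy γ hγ
  rw [AddChar.map_add_eq_mul]
  have h4 := circNorm_mul_le (addChar_ne_zero γ x) (addChar_ne_zero γ y)
  simp only at h2 h3 ⊢
  linarith

lemma bohr_mono {s t : ℝ} (hs : 0 < s) (hst : s ≤ t) (h1 : t ≤ 1) {x : G}
    (hx : x ∈ B.sets s) : x ∈ B.sets t := by
  rcases hst.eq_or_lt with rfl | hlt
  · exact hx
  · have := bohr_add_mem B hs (sub_pos.2 hlt) (by linarith) hx
      (bohr_zero_mem B (sub_pos.2 hlt) (by linarith))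
    simpa using this

/-- The admissible radii of a point relative to `X`. -/
def radSet (X : Set G) (y : G) : Set ℝ := {t | 0 < t ∧ (1 ≤ t ∨ y ∈ X + B.sets t)}

/-- The distance of `y` from `X` in the Bohr system, truncated at `1`. -/
noncomputable def rad (X : Set G) (y : G) : ℝ := sInf (radSet B X y)

lemma radSet_bdd (X : Set G) (y : G) : BddBelow (radSet B X y) := ⟨0, fun _ ht => ht.1.le⟩

lemma one_mem_radSet (X : Set G) (y : G) : (1 : ℝ) ∈ radSet B X y := ⟨one_pos, Or.inl le_rfl⟩

lemma rad_add_le (X : Set G) {s : ℝ} (hs : 0 < s) {x : G} (hx : x ∈ B.sets s) (y : G) :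
    rad B X (y + x) ≤ rad B X y + s := by
  rw [← sub_le_iff_le_add]
  refine le_csInf ⟨1, one_mem_radSet B X y⟩ ?_
  rintro t ⟨ht, h⟩
  rw [sub_le_iff_le_add]
  refine csInf_le (radSet_bdd B X _) ⟨by linarith, ?_⟩
  by_cases h1 : 1 ≤ t + s
  · exact Or.inl h1
  · right
    rcases h with h | h
    · exact absurd (by linarith) h1
    · obtain ⟨a, ha, b, hb, rfl⟩ := h
      refine ⟨a, ha, b + x, bohr_add_mem B ht hs (by linarith) hb hx, ?_⟩
      simp only [add_assoc]

lemma rad_lt_one {X : Set G} {y : G} (h : rad B X y < 1) : y ∈ X + B.sets 1 := by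
  obtain ⟨t, ⟨ht, h1⟩, h2⟩ := exists_lt_of_csInf_lt ⟨1, one_mem_radSet B X y⟩ h
  rcases h1 with h1 | h1
  · linarith
  · obtain ⟨a, ha, b, hb, rfl⟩ := h1
    exact ⟨a, ha, b, bohr_mono B ht h2.le le_rfl hb, rfl⟩

lemma rad_nonpos {X : Set G} {y : G} (h : y ∈ X) : rad B X y ≤ 0 := by
  refine le_of_forall_pos_le_add fun e he => ?_
  rw [zero_add]
  refine csInf_le (radSet_bdd B X _) ⟨he, ?_⟩
  by_cases h1 : 1 ≤ e
  · exact Or.inl h1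
  · exact Or.inr ⟨y, h, 0, bohr_zero_mem B he (by linarith), by simp⟩

end BohrFacts

/-- The truncated exponential profile. -/
noncomputable def prof (L t : ℝ) : ℝ := max (Real.exp (-(2 * L * t)) - Real.exp (-L)) 0

lemma prof_nonneg (L t : ℝ) : 0 ≤ prof L t := le_max_right _ _

lemma prof_anti {L : ℝ} (hL : 0 < L) {s t : ℝ} (h : s ≤ t) : prof L t ≤ prof L s := by
  unfold prof
  gcongr

lemma prof_zero {L : ℝ} (hL : 0 < L) {t : ℝ} (h : 1 / 2 ≤ t) : prof L t = 0 := by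
  unfold prof
  apply max_eq_right
  rw [sub_nonpos, Real.exp_le_exp]
  nlinarith

lemma prof_shift {L : ℝ} (hL : 0 < L) {s : ℝ} (hs : 0 ≤ s) (t : ℝ) :
    prof L t ≤ Real.exp (2 * L * s) * prof L (t + s)
      + (Real.exp (2 * L * s) - 1) * Real.exp (-L) := by
  have hE : 1 ≤ Real.exp (2 * L * s) := Real.one_le_exp (by positivity)
  have h1 : Real.exp (-(2 * L * t)) = Real.exp (2 * L * s) * Real.exp (-(2 * L * (t + s))) := by
    rw [← Real.exp_add]; ring_nf
  have h2 : Real.exp (-(2 * L * (t + s))) - Real.exp (-L) ≤ prof L (t + s) := le_max_left _ _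
  have h3 := prof_nonneg L (t + s)
  have h4 := Real.exp_pos (-L)
  have h5 := mul_le_mul_of_nonneg_left h2 (by linarith : 0 ≤ Real.exp (2 * L * s))
  unfold prof at h3 h5 ⊢
  apply max_le
  · rw [h1]; nlinarith
  · have := mul_nonneg (by linarith : 0 ≤ Real.exp (2 * L * s)) h3
    have := mul_nonneg (by linarith : 0 ≤ Real.exp (2 * L * s) - 1) h4.le
    linarith

lemma sum_shift {G : Type} [Fintype G] {L s : ℝ} (hL : 0 < L) (hs : 0 ≤ s)
    (r : G → ℝ) (Y : Set G) (hY : ∀ y, y ∉ Y → prof L (r y) = 0) :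
    ∑ y, prof L (r y) ≤ Real.exp (2 * L * s) * ∑ y, prof L (r y + s)
      + (Real.exp (2 * L * s) - 1) * (Real.exp (-L) * (Nat.card Y : ℝ)) := by
  classical
  have hE : 1 ≤ Real.exp (2 * L * s) := Real.one_le_exp (by positivity)
  have hc : (Nat.card Y : ℝ) = ∑ y : G, if y ∈ Y then (1 : ℝ) else 0 := by
    simp [Nat.card_eq_fintype_card, Fintype.card_subtype]
  rw [hc, Finset.mul_sum, Finset.mul_sum, Finset.mul_sum, ← Finset.sum_add_distrib]
  refine Finset.sum_le_sum fun y _ => ?_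
  split_ifs with h
  · rw [mul_one]; exact prof_shift hL hs _
  · rw [hY y h]
    have := mul_nonneg (by linarith : 0 ≤ Real.exp (2 * L * s)) (prof_nonneg L (r y + s))
    simpa using this

lemma isProb_div {G : Type} [Fintype G] {f : G → ℝ} (hf : ∀ x, 0 ≤ f x)
    (hS : 0 < ∑ x, f x) : IsProb (fun x => f x / ∑ z, f z) :=
  ⟨fun x => div_nonneg (hf x) hS.le, by rw [← Finset.sum_div, div_self hS.ne']⟩

/-- Proposition 3.1, existence of approximately invariant measures. -/
theorem statement16 :
    ∀ (G : Type) [AddCommGroup G] [Fintype G],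
      ∀ (B : BohrSystem G) (X : Set G) (K : ℝ),
        X.Nonempty → haar (X + B.sets 1) ≤ K * haar X →
        ∃ lam : ℝ, 0 < lam ∧ lam ≤ 1 ∧ 1 / (24 * Real.log (2 * K)) ≤ lam ∧
          ∃ w : G → ℝ, IsProb w ∧ ApproxInvariant (fun η => B.sets (lam * η)) w ∧
            ∀ y : G, w y ≠ 0 → y ∈ X + B.sets 1 := by
  intro G _ _ B X K hX hK
  classical
  set Y : Set G := X + B.sets 1 with hYdef
  have hXY : X ⊆ Y := fun x hx => ⟨x, hx, 0, bohr_zero_mem B one_pos le_rfl, by simp⟩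
  have hG : (0 : ℝ) < Fintype.card G := by
    have : Nonempty G := ⟨0⟩
    exact_mod_cast Fintype.card_pos
  have hXpos : (1 : ℝ) ≤ Nat.card X := by
    have := hX.to_subtype
    exact_mod_cast Nat.card_pos
  have hXYc : (Nat.card X : ℝ) ≤ Nat.card Y := by
    exact_mod_cast Nat.card_mono (Set.toFinite Y) hXY
  have hYK : (Nat.card Y : ℝ) ≤ K * Nat.card X := by
    unfold haar at hK
    rw [← mul_div_assoc, div_le_div_iff_of_pos_right hG] at hK
    exact hK
  have hK1 : 1 ≤ K := by
    by_contra h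
    push Not at h
    nlinarith
  set L := Real.log (2 * K) with hLdef
  have hL2 : 0.69 < L := by
    have h1 : Real.log 2 ≤ L := Real.log_le_log (by norm_num) (by linarith)
    have := Real.log_two_gt_d9
    linarith
  have hL : 0 < L := by linarith
  have hq : Real.exp (-L) = 1 / (2 * K) := by
    rw [Real.exp_neg, hLdef, Real.exp_log (by linarith), one_div]
  have hqY : Real.exp (-L) * (Nat.card Y : ℝ) ≤ Nat.card X / 2 := by
    rw [hq, div_mul_eq_mul_div, one_mul, div_le_div_iff₀ (by linarith) (by norm_num)]
    linarith
  have hq2 : Real.exp (-L) ≤ 1 / 2 := by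
    rw [hq]
    exact one_div_le_one_div_of_le (by norm_num) (by linarith)
  set r : G → ℝ := rad B X with hr
  have hsupp : ∀ s : ℝ, s ≤ 1 / 2 → ∀ y, y ∉ Y → prof L (r y - s) = 0 := by
    intro s hs y hy
    apply prof_zero hL
    have : 1 ≤ r y := by
      by_contra h
      push Not at h
      exact hy (rad_lt_one B h)
    linarith
  have hsupp0 : ∀ y, y ∉ Y → prof L (r y) = 0 := by
    intro y hy
    simpa using hsupp 0 (by norm_num) y hy
  set S := ∑ y, prof L (r y) with hS
  have hSX : (Nat.card X : ℝ) / 2 ≤ S := by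
    have hc : (Nat.card X : ℝ) = ∑ y : G, if y ∈ X then (1 : ℝ) else 0 := by
      simp [Nat.card_eq_fintype_card, Fintype.card_subtype]
    rw [hc, Finset.sum_div]
    refine Finset.sum_le_sum fun y _ => ?_
    split_ifs with h
    · have h1 : prof L 0 ≤ prof L (r y) := prof_anti hL (rad_nonpos B h)
      have h2 : 1 - Real.exp (-L) ≤ prof L 0 := by
        have := le_max_left (Real.exp (-(2 * L * 0)) - Real.exp (-L)) 0
        simpa [prof] using this
      linarith
    · simpa using prof_nonneg L (r y)
  have hSpos : 0 < S := by linarith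
  have hlam : 0 < 1 / (24 * L) := by positivity
  have hlam1 : 1 / (24 * L) ≤ 1 / 2 :=
    one_div_le_one_div_of_le (by norm_num) (by linarith)
  refine ⟨1 / (24 * L), hlam, by linarith, le_rfl, fun y => prof L (r y) / S,
    isProb_div (fun y => prof_nonneg L (r y)) hSpos, ?_, ?_⟩
  swap
  · intro y hy
    by_contra h
    exact hy (by simp [hsupp0 y h])
  intro η hη hη1
  set s := 1 / (24 * L) * η with hs
  have hs0 : 0 < s := by positivity
  have hs1 : s ≤ 1 / 2 := by nlinarith
  have hcs : 2 * L * s = η / 12 := by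
    rw [hs]; field_simp; norm_num
  set E := Real.exp (2 * L * s) with hE
  have hE1 : 1 ≤ E := Real.one_le_exp (by positivity)
  have hE2 : E ≤ 1 + η / 2 := by
    have h1 : E * Real.exp (-(2 * L * s)) = 1 := by
      rw [hE, ← Real.exp_add]; simp
    have h2 := Real.add_one_le_exp (-(2 * L * s))
    have h3 : E * (-(2 * L * s) + 1) ≤ 1 :=
      (mul_le_mul_of_nonneg_left h2 (by linarith)).trans_eq h1
    rw [hcs] at h3
    nlinarith
  set P := ∑ y, prof L (r y - s) with hP
  set M := ∑ y, prof L (r y + s) with hM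
  have hPS : P ≤ (1 + η) * S := by
    have h := sum_shift hL hs0.le (fun y => r y - s) Y (hsupp s hs1)
    simp only [sub_add_cancel] at h
    rw [← hP, ← hS, ← hE] at h
    have h2 : (E - 1) * (Real.exp (-L) * (Nat.card Y : ℝ)) ≤ (E - 1) * S :=
      mul_le_mul_of_nonneg_left (by linarith) (by linarith)
    nlinarith
  have hMS0 : S ≤ E * M + (E - 1) * S := by
    have h := sum_shift hL hs0.le r Y hsupp0
    rw [← hM, ← hS, ← hE] at h
    have h2 : (E - 1) * (Real.exp (-L) * (Nat.card Y : ℝ)) ≤ (E - 1) * S :=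
      mul_le_mul_of_nonneg_left (by linarith) (by linarith)
    linarith
  have hMpos : 0 < M := by
    by_contra h
    push Not at h
    nlinarith
  have hMS : (1 - η) * S ≤ M := by
    have h1 : (1 - η) * E ≤ 2 - E := by nlinarith
    have h2 : E * ((1 - η) * S) ≤ E * M := by nlinarith
    exact le_of_mul_le_mul_left h2 (by linarith)
  have hPpos : 0 < P :=
    lt_of_lt_of_le hSpos (Finset.sum_le_sum fun y _ => prof_anti hL (by linarith))
  refine ⟨fun y => prof L (r y - s) / P, fun y => prof L (r y + s) / M,
    isProb_div (fun y => prof_nonneg L _) hPpos, isProb_div (fun y => prof_nonneg L _) hMpos, ?_⟩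
  intro x hx y
  have hx' : x ∈ B.sets s := hx
  have h1 : r y ≤ r (y - x) + s := by
    have := rad_add_le B X hs0 hx' (y - x)
    rwa [sub_add_cancel] at this
  have h2 : r (y - x) ≤ r y + s := by
    have := rad_add_le B X hs0 (bohr_neg_mem B hs0 (by linarith) hx') y
    rwa [← sub_eq_add_neg] at this
  have h3 : prof L (r y + s) ≤ prof L (r (y - x)) := prof_anti hL h2
  have h4 : prof L (r (y - x)) ≤ prof L (r y - s) := prof_anti hL (by linarith)
  constructor
  · simp only
    rw [← mul_div_assoc, div_le_div_iff₀ hMpos hSpos]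
    have a1 := mul_le_mul_of_nonneg_right hMS (prof_nonneg L (r y + s))
    have a2 := mul_le_mul_of_nonneg_right h3 hMpos.le
    linarith
  · simp only
    rw [← mul_div_assoc, div_le_div_iff₀ hSpos hPpos]
    have a1 := mul_le_mul_of_nonneg_right hPS (prof_nonneg L (r y - s))
    have a2 := mul_le_mul_of_nonneg_right h4 hPpos.le
    linarith

end Paper
end

section
/- Let G be a finite abelian group and B a Bohr system on G with width w(B) < 1/4. Then dim* B ≤ log₂ C(B₁; B_{1/8}) ≤ 3·dim* B. -/
open scoped BigOperators Pointwise ENNReal ENat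
open Real

namespace Paper

theorem circNorm_div_le (z w : ℂ) (hz : z ≠ 0) (hw : w ≠ 0)
    (h1 : circNorm z < 1 / 4) (h2 : circNorm w < 1 / 4) :
    circNorm (z / w) ≤ circNorm z + circNorm w := by
  have hp := Real.pi_pos
  unfold circNorm at *
  rw [div_lt_iff₀ (by positivity)] at h1 h2
  have h1' := abs_lt.1 h1
  have h2' := abs_lt.1 h2
  have hwarg : w⁻¹.arg = - w.arg := by
    rw [Complex.arg_inv, if_neg]
    intro h
    rw [h] at h2'
    linarith
  have : (z / w).arg = z.arg - w.arg := by
    rw [div_eq_mul_inv, (Complex.arg_mul_eq_add_arg_iff hz (inv_ne_zero hw)).2, hwarg]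
    · ring
    · rw [hwarg]; constructor <;> linarith
  rw [this, ← add_div]
  gcongr
  exact abs_sub _ _

theorem circNorm_pow (z : ℂ) (hz : z ≠ 0) (n : ℕ) (h : n * circNorm z < 1 / 2) :
    circNorm (z ^ n) = n * circNorm z := by
  have hp := Real.pi_pos
  have h' : n * |z.arg| < Real.pi := by
    unfold circNorm at h
    rw [← mul_div_assoc, div_lt_iff₀ (by positivity)] at h
    linarith
  have key : (z ^ n).arg = n * z.arg := by
    clear h
    induction n with
    | zero => simp
    | succ n ih =>
      have h0 := abs_nonneg z.arg
      push_cast at h'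
      have hn : (n : ℝ) * |z.arg| < Real.pi := by linarith
      have ih := ih hn
      have hb : |((n : ℝ) + 1) * z.arg| < Real.pi := by
        rw [abs_mul, abs_of_nonneg (by positivity)]; exact h'
      have hb := abs_lt.1 hb
      rw [pow_succ, (Complex.arg_mul_eq_add_arg_iff (pow_ne_zero _ hz) hz).2, ih]
      · push_cast; ring
      · rw [ih]; constructor <;> linarith
  unfold circNorm
  rw [key, abs_mul, abs_of_nonneg (by positivity), mul_div_assoc]

theorem circNorm_one : circNorm 1 = 0 := by simp [circNorm]

theorem circNorm_nonneg (z : ℂ) : 0 ≤ circNorm z := by unfold circNorm; positivity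

theorem cov_le {H : Type} [AddCommGroup H] {S T : Set H} (X : Finset H)
    (h : S ⊆ (X : Set H) + T) : enatReal (coveringNumber S T) ≤ X.card := by
  have : coveringNumber S T ≤ (X.card : ℕ∞) := sInf_le ⟨X, rfl, h⟩
  unfold enatReal
  exact_mod_cast ENat.toNat_le_of_le_natCast this

theorem cov_exists {H : Type} [AddCommGroup H] [Fintype H] {S T : Set H} (hT : (0 : H) ∈ T) :
    ∃ X : Finset H, enatReal (coveringNumber S T) = X.card ∧ S ⊆ (X : Set H) + T := by
  have hne : {n : ℕ∞ | ∃ X : Finset H, (X.card : ℕ∞) = n ∧ S ⊆ (X : Set H) + T}.Nonempty :=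
    ⟨_, Finset.univ, rfl, fun x _ => Set.mem_add.2 ⟨x, by simp, 0, hT, by simp⟩⟩
  obtain ⟨X, hX, hS⟩ := csInf_mem hne
  refine ⟨X, ?_, hS⟩
  unfold enatReal coveringNumber
  rw [← hX]; simp

theorem cov_pos {H : Type} [AddCommGroup H] [Fintype H] {S T : Set H} (hT : (0 : H) ∈ T)
    (hS : (0 : H) ∈ S) : 1 ≤ enatReal (coveringNumber S T) := by
  obtain ⟨X, hX, h⟩ := cov_exists (S := S) hT
  obtain ⟨x, hx, -⟩ := Set.mem_add.1 (h hS)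
  rw [hX]
  exact_mod_cast Finset.card_pos.2 ⟨x, hx⟩

theorem cov_trans {H : Type} [AddCommGroup H] [Fintype H] {S T U : Set H} (hT : (0 : H) ∈ T)
    (hU : (0 : H) ∈ U) : enatReal (coveringNumber S U) ≤
      enatReal (coveringNumber S T) * enatReal (coveringNumber T U) := by
  classical
  obtain ⟨X, hX, h⟩ := cov_exists (S := S) hT
  obtain ⟨Y, hY, h'⟩ := cov_exists (S := T) hU
  rw [hX, hY]
  refine (cov_le (X + Y) ?_).trans (by exact_mod_cast Finset.card_add_le)
  rw [Finset.coe_add, add_assoc]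
  exact h.trans (Set.add_subset_add_left h')

theorem cov_main {G : Type} [AddCommGroup G] [Fintype G] (Γ : Set (AddChar G ℂ))
    (δ : AddChar G ℂ → ℝ) (hpos : ∀ γ ∈ Γ, 0 < δ γ) (hlt : ∀ γ ∈ Γ, δ γ < 1 / 4)
    (F : ℝ → Set G) (hF : ∀ η : ℝ, 0 < η → η ≤ 1 → F η = bohrSet Γ (fun γ => η * δ γ))
    (η : ℝ) (h0 : 0 < η) (h1 : η ≤ 1) :
    enatReal (coveringNumber (F η) (F (η / 2))) ≤ enatReal (coveringNumber (F 1) (F (1 / 8))) := by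
  classical
  have hne : ∀ (γ : AddChar G ℂ) (x : G), γ x ≠ 0 := by
    intro γ x h
    have h2 := AddChar.map_add_eq_mul γ x (-x)
    rw [h, add_neg_cancel, AddChar.map_zero_eq_one, zero_mul] at h2
    exact one_ne_zero h2
  obtain ⟨k, hk1, hk2⟩ : ∃ k : ℕ, 2 ^ k * η ≤ 1 ∧ 1 < 2 ^ (k + 1) * η := by
    obtain ⟨n, hn1, hn2⟩ := exists_nat_pow_near (x := 1 / η) (y := (2 : ℝ))
      (by rwa [le_div_iff₀ h0, one_mul]) (by norm_num)
    exact ⟨n, by rwa [le_div_iff₀ h0] at hn1, by rwa [div_lt_iff₀ h0] at hn2⟩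
  have hm : ∀ t : ℝ, 0 < t → t ≤ 1 → (0 : G) ∈ F t := by
    intro t ht ht'
    rw [hF t ht ht']
    intro γ hγ
    simp only [AddChar.map_zero_eq_one, circNorm_one]
    exact mul_pos ht (hpos γ hγ)
  obtain ⟨X, hX, hcov⟩ := cov_exists (S := F 1) (hm (1 / 8) (by norm_num) (by norm_num))
  rw [hX]
  rw [hF _ (by norm_num) (by norm_num), hF _ (by norm_num) (by norm_num)] at hcov
  rw [hF η h0 h1, hF (η / 2) (by positivity) (by linarith)]
  let P : G → G → Prop := fun z x => x ∈ bohrSet Γ (fun γ => η * δ γ) ∧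
    ∃ b ∈ bohrSet Γ (fun γ => 1 / 8 * δ γ), z + b = 2 ^ k • x
  let f : G → G := fun z => if h : ∃ x, P z x then h.choose else 0
  have hf : ∀ z x, P z x → P z (f z) := by
    intro z x h
    have h' : ∃ x, P z x := ⟨x, h⟩
    simp only [f, dif_pos h']
    exact h'.choose_spec
  refine (cov_le (X.image f) ?_).trans (by exact_mod_cast Finset.card_image_le)
  intro x hx
  have hpow : ∀ γ ∈ Γ, circNorm (γ x) < η * δ γ := hx
  have hx1 : (2 ^ k • x) ∈ bohrSet Γ (fun γ => 1 * δ γ) := by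
    intro γ hγ
    have a := hpow γ hγ
    have b := hlt γ hγ
    have c := hpos γ hγ
    have d : (2 : ℝ) ^ k * circNorm (γ x) < δ γ := by
      calc (2 : ℝ) ^ k * circNorm (γ x) < 2 ^ k * (η * δ γ) := by gcongr
        _ = (2 ^ k * η) * δ γ := by ring
        _ ≤ 1 * δ γ := by gcongr
        _ = δ γ := one_mul _
    rw [AddChar.map_nsmul_eq_pow, circNorm_pow _ (hne _ _)] <;> push_cast <;> linarith
  obtain ⟨z, hz, b, hb, hzb⟩ := Set.mem_add.1 (hcov hx1)
  obtain ⟨hy, b', hb', hzb'⟩ := hf z x ⟨hx, b, hb, hzb⟩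
  refine Set.mem_add.2 ⟨f z, by simpa using ⟨z, hz, rfl⟩, x - f z, ?_, by abel⟩
  intro γ hγ
  have b1 := hlt γ hγ
  have c := hpos γ hγ
  have a1 := hpow γ hγ
  have a2 : circNorm (γ (f z)) < η * δ γ := hy γ hγ
  have a3 : circNorm (γ b) < 1 / 8 * δ γ := hb γ hγ
  have a4 : circNorm (γ b') < 1 / 8 * δ γ := hb' γ hγ
  have hηδ : η * δ γ ≤ δ γ := by nlinarith
  have e1 : circNorm (γ (x - f z)) ≤ circNorm (γ x) + circNorm (γ (f z)) := by
    rw [AddChar.map_sub_eq_div]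
    exact circNorm_div_le _ _ (hne _ _) (hne _ _) (by linarith) (by linarith)
  have e2 : circNorm (γ (b - b')) ≤ circNorm (γ b) + circNorm (γ b') := by
    rw [AddChar.map_sub_eq_div]
    exact circNorm_div_le _ _ (hne _ _) (hne _ _) (by linarith) (by linarith)
  have e3 : b - b' = 2 ^ k • (x - f z) := by
    rw [smul_sub, ← hzb, ← hzb']; abel
  have d : (2 : ℝ) ^ k * circNorm (γ (x - f z)) < 1 / 2 := by
    calc (2 : ℝ) ^ k * circNorm (γ (x - f z)) ≤ 2 ^ k * (2 * (η * δ γ)) := by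
          gcongr; linarith
      _ = (2 ^ k * η) * (2 * δ γ) := by ring
      _ ≤ 1 * (2 * δ γ) := by gcongr
      _ < 1 / 2 := by linarith
  rw [e3, AddChar.map_nsmul_eq_pow, circNorm_pow _ (hne _ _) _ (by push_cast; exact d)] at e2
  push_cast at e2
  have hfin : (2 : ℝ) ^ k * circNorm (γ (x - f z)) < 2 ^ k * (η / 2 * δ γ) := by
    have : 1 / 4 * δ γ ≤ 2 ^ k * (η / 2 * δ γ) := by
      calc 1 / 4 * δ γ ≤ (2 ^ (k + 1) * η) / 4 * δ γ := by gcongr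
        _ = _ := by ring
    linarith
  exact lt_of_mul_lt_mul_left hfin (by positivity)

/-- Lemma 3.2, growth and doubling dimension. -/
theorem statement17 :
    ∀ (G : Type) [AddCommGroup G] [Fintype G],
      ∀ B : BohrSystem G, B.width < 1 / 4 →
        B.dimStar ≤ Real.logb 2 (enatReal (coveringNumber (B.sets 1) (B.sets (1 / 8)))) ∧
        Real.logb 2 (enatReal (coveringNumber (B.sets 1) (B.sets (1 / 8)))) ≤
          3 * B.dimStar := by
  intro G _ _ B hw
  obtain ⟨r, ⟨Γ, δ, ⟨hpos, hF⟩, rfl⟩, hr⟩ := exists_lt_of_csInf_lt (by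
    obtain ⟨Γ, δ, h⟩ := B.exists_gen
    exact ⟨_, Γ, δ, h, rfl⟩) hw
  have hlt : ∀ γ ∈ Γ, δ γ < 1 / 4 := fun γ hγ =>
    (le_csSup ((Set.toFinite Γ).image δ).bddAbove ⟨γ, hγ, rfl⟩).trans_lt hr
  have hm : ∀ t : ℝ, 0 < t → t ≤ 1 → (0 : G) ∈ B.sets t := by
    intro t ht ht'
    rw [hF t ht ht']
    intro γ hγ
    simp only [AddChar.map_zero_eq_one, circNorm_one]
    exact mul_pos ht (hpos γ hγ)
  have hub : ∀ r ∈ {r : ℝ | ∃ η : ℝ, 0 < η ∧ η ≤ 1 ∧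
      r = Real.logb 2 (enatReal (coveringNumber (B.sets η) (B.sets (η / 2))))},
      r ≤ Real.logb 2 (enatReal (coveringNumber (B.sets 1) (B.sets (1 / 8)))) := by
    rintro r ⟨η, h0, h1, rfl⟩
    refine Real.logb_le_logb_of_le (by norm_num) ?_ (cov_main Γ δ hpos hlt B.sets hF η h0 h1)
    exact zero_lt_one.trans_le (cov_pos (hm _ (by positivity) (by linarith)) (hm _ h0 h1))
  have hle : ∀ η : ℝ, 0 < η → η ≤ 1 →
      Real.logb 2 (enatReal (coveringNumber (B.sets η) (B.sets (η / 2)))) ≤ B.dimStar :=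
    fun η h0 h1 => le_csSup ⟨_, hub⟩ ⟨η, h0, h1, rfl⟩
  refine ⟨csSup_le ⟨_, 1, one_pos, le_rfl, rfl⟩ hub, ?_⟩
  have l1 := hle 1 (by norm_num) (by norm_num)
  have l2 := hle (1 / 2) (by norm_num) (by norm_num)
  have l3 := hle (1 / 4) (by norm_num) (by norm_num)
  rw [show (1 / 2 / 2 : ℝ) = 1 / 4 by norm_num] at l2
  rw [show (1 / 4 / 2 : ℝ) = 1 / 8 by norm_num] at l3
  have m1 := hm 1 (by norm_num) (by norm_num)
  have m2 := hm (1 / 2) (by norm_num) (by norm_num)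
  have m4 := hm (1 / 4) (by norm_num) (by norm_num)
  have m8 := hm (1 / 8) (by norm_num) (by norm_num)
  have p1 := cov_pos m2 m1
  have p2 := cov_pos m4 m2
  have p3 := cov_pos m8 m4
  have p := cov_pos m8 m1
  have t1 := cov_trans (S := B.sets 1) m2 m8
  have t2 := cov_trans (S := B.sets (1 / 2)) m4 m8
  have t : enatReal (coveringNumber (B.sets 1) (B.sets (1 / 8))) ≤
      enatReal (coveringNumber (B.sets 1) (B.sets (1 / 2))) *
      (enatReal (coveringNumber (B.sets (1 / 2)) (B.sets (1 / 4))) *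
      enatReal (coveringNumber (B.sets (1 / 4)) (B.sets (1 / 8)))) :=
    t1.trans (mul_le_mul_of_nonneg_left t2 (by linarith))
  have t' := Real.logb_le_logb_of_le (b := 2) (by norm_num) (by linarith) t
  rw [Real.logb_mul (by positivity) (by positivity),
    Real.logb_mul (by positivity) (by positivity)] at t'
  linarith

end Paper
end

section
/- Let G be a finite abelian group and B a Bohr system on G of rank 1 (i.e., B can be generated by a pair (Γ,δ) with |Γ| = 1). Then dim* B ≤ log₂ 3. -/
open scoped BigOperators Pointwise ENNReal ENat
open Real

namespace Paper

theorem cover_aux {G : Type} [AddCommGroup G] [Fintype G] (γ : AddChar G ℂ) (r : ℝ)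
    (hr : 0 < r) :
    coveringNumber {x : G | circNorm (γ x) < r} {x : G | circNorm (γ x) < r / 2} ≤ 3 := by
  classical
  have hne : ∀ x, γ x ≠ 0 := fun x => (γ.val_isUnit x).ne_zero
  have hpi := Real.pi_pos
  have hcn : ∀ z t, circNorm z < t ↔ |z.arg| < t * (2 * π) := by
    intro z t
    unfold circNorm
    rw [div_lt_iff₀ (by positivity)]
  have hneg : ∀ x, |(γ (-x)).arg| = |(γ x).arg| := by
    intro x
    rw [AddChar.map_neg_eq_inv, Complex.abs_arg_inv]
  have hsub : ∀ x y, 0 ≤ (γ x).arg → (γ x).arg ≤ (γ y).arg →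
      (γ (y - x)).arg = (γ y).arg - (γ x).arg := by
    intro x y h0 h1
    have h2 := Complex.arg_le_pi (γ y)
    have h := Complex.arg_div_coe_angle (hne y) (hne x)
    rw [← AddChar.map_sub_eq_div, ← Real.Angle.coe_sub] at h
    have h' := congrArg Real.Angle.toReal h
    rw [Complex.arg_coe_angle_toReal_eq_arg] at h'
    rw [h', Real.Angle.toReal_coe_eq_self_iff]
    constructor <;> linarith
  have key : ∀ X : Finset G, X.card ≤ 3 →
      {x : G | circNorm (γ x) < r} ⊆ (X : Set G) + {x : G | circNorm (γ x) < r / 2} →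
      coveringNumber {x : G | circNorm (γ x) < r} {x : G | circNorm (γ x) < r / 2} ≤ 3 := by
    intro X hX hS
    refine le_trans (sInf_le ⟨X, rfl, hS⟩) ?_
    exact_mod_cast hX
  set s : Finset G := Finset.univ.filter
    (fun x => r / 2 * (2 * π) ≤ (γ x).arg ∧ (γ x).arg < r * (2 * π)) with hs
  have hrp : 0 < r / 2 * (2 * π) := by positivity
  -- every uncovered point lies in `s` up to sign
  have hsign : ∀ y, circNorm (γ y) < r → ¬ circNorm (γ y) < r / 2 → y ∈ s ∨ -y ∈ s := by
    intro y hy hy'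
    rw [hcn] at hy hy'
    simp only [hs, Finset.mem_filter, Finset.mem_univ, true_and]
    rcases le_or_gt 0 (γ y).arg with h | h
    · left
      rw [abs_of_nonneg h] at hy hy'
      exact ⟨not_lt.1 hy', hy⟩
    · right
      rw [abs_of_neg h] at hy hy'
      have : (γ (-y)).arg = -(γ y).arg := by
        rw [AddChar.map_neg_eq_inv, Complex.arg_inv, if_neg (by linarith)]
      rw [this]
      exact ⟨not_lt.1 hy', hy⟩
  rcases s.eq_empty_or_nonempty with he | hn
  · refine key {0} (by simp) ?_
    intro y hy
    refine Set.mem_add.2 ⟨0, by simp, y, ?_, by simp⟩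
    by_contra hy'
    rcases hsign y hy hy' with h | h <;> simp [he] at h
  · obtain ⟨x, hx, hmin⟩ := s.exists_min_image (fun x => (γ x).arg) hn
    have hcov : ∀ y ∈ s, circNorm (γ (y - x)) < r / 2 := by
      intro y hy
      have h1 := hmin y hy
      simp only [hs, Finset.mem_filter, Finset.mem_univ, true_and] at hx hy
      rw [hcn, hsub x y (by linarith) h1, abs_of_nonneg (by linarith)]
      linarith
    refine key {0, x, -x} Finset.card_le_three ?_
    intro y hy
    by_cases hy' : circNorm (γ y) < r / 2
    · exact Set.mem_add.2 ⟨0, by simp, y, hy', by simp⟩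
    rcases hsign y hy hy' with h | h
    · exact Set.mem_add.2 ⟨x, by simp, y - x, hcov y h, by abel⟩
    · refine Set.mem_add.2 ⟨-x, by simp, y + x, ?_, by abel⟩
      have h2 := hcov _ h
      rw [hcn, show -y - x = -(y + x) by abel, hneg, ← hcn] at h2
      exact h2

/-- Lemma 3.3, rank 1 Bohr systems. -/
theorem statement18 :
    ∀ (G : Type) [AddCommGroup G] [Fintype G],
      ∀ B : BohrSystem G,
        (∃ (Γ : Set (AddChar G ℂ)) (δ : AddChar G ℂ → ℝ),
          IsBohrGen Γ δ B.sets ∧ Γ.ncard = 1) →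
        B.dimStar ≤ Real.logb 2 3 := by
  intro G _ _ B ⟨Γ, δ, ⟨hδ, hB⟩, hΓ⟩
  obtain ⟨γ, rfl⟩ := Set.ncard_eq_one.1 hΓ
  have h3 : 0 ≤ Real.logb 2 3 := Real.logb_nonneg (by norm_num) (by norm_num)
  refine Real.sSup_le ?_ h3
  rintro r ⟨η, h0, h1, rfl⟩
  have hγ := hδ γ rfl
  have h := cover_aux γ (η * δ γ) (by positivity)
  rw [hB η h0 h1, hB (η / 2) (by linarith) (by linarith)]
  have e : ∀ t : ℝ, bohrSet {γ} (fun γ => t * δ γ) = {x : G | circNorm (γ x) < t * δ γ} := by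
    intro t
    ext x
    simp [bohrSet]
  rw [e, e, show η / 2 * δ γ = η * δ γ / 2 by ring]
  have hn := ENat.toNat_le_of_le_coe (n := 3) h
  unfold enatReal
  rcases Nat.eq_zero_or_pos (coveringNumber {x : G | circNorm (γ x) < η * δ γ}
    {x : G | circNorm (γ x) < η * δ γ / 2}).toNat with hz | hz
  · rw [hz]
    simpa using h3
  · refine Real.logb_le_logb_of_le (by norm_num) (by exact_mod_cast hz) (by exact_mod_cast hn)

end Paper
end
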